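/- arXiv:2009.11854 — 4 statements merged into one kernel-verified Lean document; each statement's English description precedes it below -/
import Mathlib

section
/- Let α, β > 0 be real numbers with max{α, β} = 1, and set γ = min{α, β}. Then there exists a constant C > 0, depending only on α and β, such that for all real t ≥ 2 one has ∫_1^{t−1} s^{−α} (t−s)^{−β} ds ≤ C · t^{−γ} · log t. -/
theorem inv_mul_rpow_neg_le {s u β : ℝ} (hs : 0 < s) (hu : 0 < u) (hβ : 0 ≤ β) (hβ' : β ≤ 1) :
    s⁻¹ * u ^ (-β) ≤ (s + u) ^ (-β) * (2 * (s⁻¹ + u⁻¹)) := by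
  have hsum : (s + u) ^ β ≤ s ^ β + u ^ β := Real.rpow_add_le_add_rpow hs.le hu.le hβ hβ'
  have hyoung : s⁻¹ ^ (1 - β) * u⁻¹ ^ β ≤ (1 - β) * s⁻¹ + β * u⁻¹ :=
    Real.geom_mean_le_arith_mean2_weighted (by linarith) hβ (by positivity) (by positivity)
      (by ring)
  have hs1 : s⁻¹ ^ (1 - β) = s⁻¹ * s ^ β := by
    rw [Real.rpow_sub (by positivity), Real.rpow_one, Real.inv_rpow hs.le, div_inv_eq_mul]
  rw [hs1, Real.inv_rpow hu.le] at hyoung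
  have hsi : 0 < s⁻¹ := by positivity
  have hui : 0 < u⁻¹ := by positivity
  have hub : 0 < u ^ β := by positivity
  have hsub : 0 < (s + u) ^ β := by positivity
  rw [Real.rpow_neg hu.le, Real.rpow_neg (by positivity), le_inv_mul_iff₀' hsub]
  calc s⁻¹ * (u ^ β)⁻¹ * (s + u) ^ β ≤ s⁻¹ * (u ^ β)⁻¹ * (s ^ β + u ^ β) := by gcongr
    _ = s⁻¹ * s ^ β * (u ^ β)⁻¹ + s⁻¹ := by field_simp
    _ ≤ 2 * (s⁻¹ + u⁻¹) := by nlinarith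

theorem rpow_neg_mul_rpow_neg_le_of_max_eq_one {α β s u : ℝ} (hα : 0 ≤ α) (hβ : 0 ≤ β)
    (hmax : max α β = 1) (hs : 0 < s) (hu : 0 < u) :
    s ^ (-α) * u ^ (-β) ≤ (s + u) ^ (-(min α β)) * (2 * (s⁻¹ + u⁻¹)) := by
  rcases le_total α β with h | h
  · rw [max_eq_right h] at hmax
    subst hmax
    rw [min_eq_left h, Real.rpow_neg_one, mul_comm, add_comm s u, add_comm s⁻¹]
    exact inv_mul_rpow_neg_le hu hs hα h
  · rw [max_eq_left h] at hmax
    subst hmax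
    rw [min_eq_right h, Real.rpow_neg_one]
    exact inv_mul_rpow_neg_le hs hu hβ h

/-- Lemma 1.10 (case max{α,β} = 1): the convolution-type integral
∫_1^{t-1} s^{-α} (t-s)^{-β} ds is bounded by C · t^{-min{α,β}} · log t for all t ≥ 2. -/
theorem convolution_integral_bound_of_max_eq_one
    (α β : ℝ) (hα : 0 < α) (hβ : 0 < β) (hmax : max α β = 1) :
    ∃ C : ℝ, 0 < C ∧ ∀ t : ℝ, 2 ≤ t →
      (∫ s in (1:ℝ)..(t - 1), s ^ (-α) * (t - s) ^ (-β))
        ≤ C * t ^ (-(min α β)) * Real.log t := by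
  refine ⟨4, by norm_num, fun t ht => ?_⟩
  have hle : (1 : ℝ) ≤ t - 1 := by linarith
  have hpos : ∀ s ∈ Set.uIcc 1 (t - 1), 0 < s ∧ 0 < t - s := by
    intro s hs
    rw [Set.uIcc_of_le hle] at hs
    exact ⟨by linarith [hs.1], by linarith [hs.2]⟩
  have hinv : IntervalIntegrable (fun s : ℝ => s⁻¹) MeasureTheory.volume 1 (t - 1) :=
    (continuousOn_id.inv₀ fun s hs => (hpos s hs).1.ne').intervalIntegrable
  have hinv' : IntervalIntegrable (fun s : ℝ => (t - s)⁻¹) MeasureTheory.volume 1 (t - 1) :=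
    ((continuousOn_const.sub continuousOn_id).inv₀
      fun s hs => (hpos s hs).2.ne').intervalIntegrable
  have hint : IntervalIntegrable (fun s : ℝ => s ^ (-α) * (t - s) ^ (-β))
      MeasureTheory.volume 1 (t - 1) :=
    ((continuousOn_id.rpow_const fun s hs => Or.inl (hpos s hs).1.ne').mul
      ((continuousOn_const.sub continuousOn_id).rpow_const
        fun s hs => Or.inl (hpos s hs).2.ne')).intervalIntegrable
  have hlog : ∫ s in (1:ℝ)..(t - 1), s⁻¹ = Real.log (t - 1) := by
    rw [integral_inv_of_pos one_pos (by linarith), div_one]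
  have hlog' : ∫ s in (1:ℝ)..(t - 1), (t - s)⁻¹ = Real.log (t - 1) := by
    rw [intervalIntegral.integral_comp_sub_left (fun s : ℝ => s⁻¹) t, sub_sub_cancel, hlog]
  calc (∫ s in (1:ℝ)..(t - 1), s ^ (-α) * (t - s) ^ (-β))
      ≤ ∫ s in (1:ℝ)..(t - 1), t ^ (-(min α β)) * (2 * (s⁻¹ + (t - s)⁻¹)) := by
        refine intervalIntegral.integral_mono_on hle hint
          (((hinv.add hinv').const_mul 2).const_mul _) fun s hs => ?_
        obtain ⟨h1, h2⟩ := hpos s (Set.Icc_subset_uIcc hs)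
        simpa only [add_sub_cancel] using
          rpow_neg_mul_rpow_neg_le_of_max_eq_one hα.le hβ.le hmax h1 h2
    _ = 4 * t ^ (-(min α β)) * Real.log (t - 1) := by
        rw [intervalIntegral.integral_const_mul, intervalIntegral.integral_const_mul,
          intervalIntegral.integral_add hinv hinv', hlog, hlog']
        ring
    _ ≤ 4 * t ^ (-(min α β)) * Real.log t := by
        have : Real.log (t - 1) ≤ Real.log t := Real.log_le_log (by linarith) (by linarith)
        gcongr
end

section
/- Let α, β > 0 be real numbers and let θ be any real number with θ < min{α, β, α+β−1}. Then there exists a constant C > 0, depending only on α, β and θ, such that for all real t ≥ 2 one has ∫_1^{t−1} s^{−α} (t−s)^{−β} ds ≤ C · t^{−θ}. -/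
theorem Real.rpow_neg_le_two_rpow_abs_mul {u t θ : ℝ} (ht : 0 < t) (hu : t / 2 ≤ u) (hut : u ≤ t) :
    u ^ (-θ) ≤ 2 ^ |θ| * t ^ (-θ) := by
  rcases le_total 0 θ with h | h
  · calc u ^ (-θ) ≤ (t / 2) ^ (-θ) :=
          Real.rpow_le_rpow_of_nonpos (by positivity) hu (by linarith)
      _ = 2 ^ |θ| * t ^ (-θ) := by
          rw [abs_of_nonneg h, Real.div_rpow ht.le (by norm_num), Real.rpow_neg (x := 2) (by norm_num),
            div_inv_eq_mul, mul_comm]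
  · calc u ^ (-θ) ≤ t ^ (-θ) := Real.rpow_le_rpow (by linarith) hut (by linarith)
      _ ≤ 2 ^ |θ| * t ^ (-θ) := by
          refine le_mul_of_one_le_left (by positivity) ?_
          exact Real.one_le_rpow (by norm_num) (abs_nonneg θ)

theorem Real.rpow_neg_mul_rpow_neg_le {s u α β θ : ℝ} (hs : 0 < s) (hsu : s ≤ u) (hθ : θ ≤ β) :
    s ^ (-α) * u ^ (-β) ≤ 2 ^ |θ| * (s + u) ^ (-θ) * s ^ (-(α + β - θ)) := by
  have hu : 0 < u := hs.trans_le hsu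
  calc s ^ (-α) * u ^ (-β) = s ^ (-(α + β - θ)) * (s ^ (β - θ) * u ^ (-β)) := by
        rw [← mul_assoc, ← Real.rpow_add hs]
        ring_nf
    _ ≤ s ^ (-(α + β - θ)) * (u ^ (β - θ) * u ^ (-β)) := by
        gcongr
    _ = s ^ (-(α + β - θ)) * u ^ (-θ) := by
        rw [← Real.rpow_add hu]
        ring_nf
    _ ≤ s ^ (-(α + β - θ)) * (2 ^ |θ| * (s + u) ^ (-θ)) := by
        gcongr
        exact Real.rpow_neg_le_two_rpow_abs_mul (by linarith) (by linarith) (by linarith)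
    _ = _ := mul_comm _ _

theorem Real.rpow_neg_mul_rpow_neg_le_add {s u α β θ : ℝ} (hs : 0 < s) (hu : 0 < u)
    (hθα : θ ≤ α) (hθβ : θ ≤ β) :
    s ^ (-α) * u ^ (-β) ≤
      2 ^ |θ| * (s + u) ^ (-θ) * (s ^ (-(α + β - θ)) + u ^ (-(α + β - θ))) := by
  rcases le_total s u with h | h
  · refine (Real.rpow_neg_mul_rpow_neg_le hs h hθβ).trans ?_
    gcongr
    exact le_add_of_nonneg_right (by positivity)
  · rw [mul_comm (s ^ (-α)), add_comm s, add_comm α]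
    refine (Real.rpow_neg_mul_rpow_neg_le hu h hθα).trans ?_
    gcongr
    exact le_add_of_nonneg_left (by positivity)

theorem integral_one_rpow_neg_le {p b : ℝ} (hp : 1 < p) (hb : 1 ≤ b) :
    ∫ s in (1 : ℝ)..b, s ^ (-p) ≤ (p - 1)⁻¹ := by
  have h0 : (0 : ℝ) ∉ Set.uIcc 1 b := by
    rw [Set.uIcc_of_le hb]
    exact fun h => by linarith [h.1]
  rw [integral_rpow (Or.inr ⟨by linarith, h0⟩), Real.one_rpow, ← neg_div_neg_eq, ← one_div]
  have hden : -(-p + 1) = p - 1 := by ring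
  rw [hden]
  have hp' : 0 < p - 1 := by linarith
  have hpos : 0 ≤ b ^ (-p + 1) := by positivity
  gcongr
  linarith

/-- Lemma 1.10, consequence: for any θ < min{α, β, α+β−1}, the convolution-type
integral ∫_1^{t-1} s^{-α} (t-s)^{-β} ds is bounded by C · t^{-θ} for all t ≥ 2. -/
theorem convolution_integral_bound_of_lt_min
    (α β θ : ℝ) (hα : 0 < α) (hβ : 0 < β)
    (hθ : θ < min α (min β (α + β - 1))) :
    ∃ C : ℝ, 0 < C ∧ ∀ t : ℝ, 2 ≤ t →
      (∫ s in (1:ℝ)..(t - 1), s ^ (-α) * (t - s) ^ (-β))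
        ≤ C * t ^ (-θ) := by
  obtain ⟨hθα, hθβ, hθαβ⟩ : θ < α ∧ θ < β ∧ θ < α + β - 1 := by
    simpa only [lt_min_iff] using hθ
  have hp : 0 < α + β - θ - 1 := by linarith
  refine ⟨2 ^ |θ| * (2 * (α + β - θ - 1)⁻¹), by positivity, fun t ht => ?_⟩
  have hle : (1 : ℝ) ≤ t - 1 := by linarith
  have hs (q : ℝ) : ContinuousOn (fun s : ℝ => s ^ q) (Set.uIcc 1 (t - 1)) := by
    rw [Set.uIcc_of_le hle]
    exact continuousOn_id.rpow_const fun x hx => Or.inl (ne_of_gt (show 0 < x by linarith [hx.1]))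
  have hts (q : ℝ) : ContinuousOn (fun s : ℝ => (t - s) ^ q) (Set.uIcc 1 (t - 1)) := by
    rw [Set.uIcc_of_le hle]
    exact (continuousOn_const.sub continuousOn_id).rpow_const
      fun x hx => Or.inl (ne_of_gt (show 0 < t - x by linarith [hx.2]))
  have hrefl : ∫ s in (1 : ℝ)..(t - 1), (t - s) ^ (-(α + β - θ)) =
      ∫ s in (1 : ℝ)..(t - 1), s ^ (-(α + β - θ)) := by
    rw [intervalIntegral.integral_comp_sub_left (fun s => s ^ (-(α + β - θ))), sub_sub_cancel]
  have hint := integral_one_rpow_neg_le (p := α + β - θ) (by linarith) hle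
  calc ∫ s in (1 : ℝ)..(t - 1), s ^ (-α) * (t - s) ^ (-β)
      ≤ ∫ s in (1 : ℝ)..(t - 1), 2 ^ |θ| * t ^ (-θ) *
          (s ^ (-(α + β - θ)) + (t - s) ^ (-(α + β - θ))) := by
        refine intervalIntegral.integral_mono_on hle ((hs _).mul (hts _)).intervalIntegrable
          (((hs _).add (hts _)).const_mul _).intervalIntegrable fun s h => ?_
        have := Real.rpow_neg_mul_rpow_neg_le_add (s := s) (u := t - s)
          (by linarith [h.1]) (by linarith [h.2]) hθα.le hθβ.le
        rwa [add_sub_cancel] at this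
    _ = 2 ^ |θ| * t ^ (-θ) * (2 * ∫ s in (1 : ℝ)..(t - 1), s ^ (-(α + β - θ))) := by
        rw [intervalIntegral.integral_const_mul, intervalIntegral.integral_add
          (hs _).intervalIntegrable (hts _).intervalIntegrable, hrefl, two_mul]
    _ ≤ 2 ^ |θ| * t ^ (-θ) * (2 * (α + β - θ - 1)⁻¹) := by gcongr
    _ = 2 ^ |θ| * (2 * (α + β - θ - 1)⁻¹) * t ^ (-θ) := by ring
end

section
/- Let α, β > 0 be real numbers with max{α, β} ≠ 1, and set θ = min{α, β, α+β−1}. Then there exists a constant C > 0, depending only on α and β, such that for all real t ≥ 2 one has ∫_1^{t−1} s^{−α} (t−s)^{−β} ds ≤ C · t^{−θ}. -/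
theorem exists_integral_rpow_neg_le (α e : ℝ) (he : 0 ≤ e) (hαe : 1 - α ≤ e)
    (hα1 : α = 1 → 0 < e) :
    ∃ K : ℝ, 0 < K ∧ ∀ x : ℝ, 1 ≤ x → (∫ s in (1:ℝ)..x, s ^ (-α)) ≤ K * x ^ e := by
  have hmem : ∀ x : ℝ, 1 ≤ x → (0:ℝ) ∉ Set.uIcc 1 x := by
    intro x hx h
    rw [Set.uIcc_of_le hx] at h
    linarith [h.1]
  rcases lt_trichotomy α 1 with h | h | h
  · refine ⟨1 / (1 - α), one_div_pos.2 (by linarith), fun x hx => ?_⟩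
    rw [integral_rpow (Or.inr ⟨by linarith, hmem x hx⟩), Real.one_rpow, div_mul_eq_mul_div,
      one_mul, show -α + 1 = 1 - α by ring]
    have hpow := Real.rpow_le_rpow_of_exponent_le hx hαe
    have hpos : 0 < 1 - α := by linarith
    gcongr
    linarith
  · subst h
    have he' := hα1 rfl
    refine ⟨1 / e, one_div_pos.2 he', fun x hx => ?_⟩
    simp only [Real.rpow_neg_one]
    rw [integral_inv (hmem x hx), div_one, div_mul_eq_mul_div, one_mul]
    exact Real.log_le_rpow_div (by linarith) he'
  · have hpos : 0 < α - 1 := by linarith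
    refine ⟨1 / (α - 1), one_div_pos.2 hpos, fun x hx => ?_⟩
    rw [integral_rpow (Or.inr ⟨by linarith, hmem x hx⟩), Real.one_rpow, div_mul_eq_mul_div,
      one_mul, ← neg_div_neg_eq, show -(-α + 1) = α - 1 by ring]
    have hone := Real.one_le_rpow hx he
    have hnonneg := Real.rpow_nonneg (by linarith : (0:ℝ) ≤ x) (-α + 1)
    gcongr
    linarith

theorem intervalIntegrable_rpow_mul_sub_rpow (α β : ℝ) {t a b : ℝ} (hab : a ≤ b)
    (ha : 0 < a) (hb : b < t) :
    IntervalIntegrable (fun s : ℝ => s ^ (-α) * (t - s) ^ (-β)) MeasureTheory.volume a b := by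
  apply ContinuousOn.intervalIntegrable
  rw [Set.uIcc_of_le hab]
  refine ContinuousOn.mul (continuousOn_id.rpow_const fun s hs => Or.inl ?_)
    ((continuousOn_const.sub continuousOn_id).rpow_const fun s hs => Or.inl ?_)
  · exact (ha.trans_le hs.1).ne'
  · exact (sub_pos.2 (hs.2.trans_lt hb)).ne'

theorem exists_half_convolution_integral_le (α β θ : ℝ) (hβ : 0 < β) (hθβ : θ ≤ β)
    (hθ : θ ≤ α + β - 1) (hα1 : α = 1 → θ < β) :
    ∃ C : ℝ, 0 < C ∧ ∀ t : ℝ, 2 ≤ t →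
      (∫ s in (1:ℝ)..(t / 2), s ^ (-α) * (t - s) ^ (-β)) ≤ C * t ^ (-θ) := by
  obtain ⟨K, hK, hbound⟩ := exists_integral_rpow_neg_le α (β - θ) (by linarith) (by linarith)
    (fun h => by linarith [hα1 h])
  refine ⟨K * (1 / 2) ^ (-θ), by positivity, fun t ht => ?_⟩
  have hx : 1 ≤ t / 2 := by linarith
  have hx0 : 0 < t / 2 := by linarith
  calc (∫ s in (1:ℝ)..(t / 2), s ^ (-α) * (t - s) ^ (-β))
      ≤ ∫ s in (1:ℝ)..(t / 2), s ^ (-α) * (t / 2) ^ (-β) := by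
        refine intervalIntegral.integral_mono_on hx
          (intervalIntegrable_rpow_mul_sub_rpow α β hx one_pos (by linarith)) ?_ ?_
        · refine (intervalIntegral.intervalIntegrable_rpow (Or.inr ?_)).mul_const _
          rw [Set.uIcc_of_le hx]
          exact fun h => by linarith [h.1]
        · intro s hs
          have hs0 : 0 ≤ s := by linarith [hs.1]
          exact mul_le_mul_of_nonneg_left
            (Real.rpow_le_rpow_of_nonpos hx0 (by linarith [hs.2]) (by linarith))
            (Real.rpow_nonneg hs0 _)
    _ = (∫ s in (1:ℝ)..(t / 2), s ^ (-α)) * (t / 2) ^ (-β) :=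
        intervalIntegral.integral_mul_const _ _
    _ ≤ K * (t / 2) ^ (β - θ) * (t / 2) ^ (-β) := by
        gcongr
        exact hbound _ hx
    _ = K * (t / 2) ^ (-θ) := by
        rw [mul_assoc, ← Real.rpow_add hx0]
        ring_nf
    _ = K * (1 / 2) ^ (-θ) * t ^ (-θ) := by
        rw [mul_assoc, ← Real.mul_rpow (by norm_num) (by linarith)]
        ring_nf


/-- Lemma 1.10, consequence: if max{α,β} ≠ 1 and θ = min{α, β, α+β−1}, then the
convolution-type integral ∫_1^{t-1} s^{-α} (t-s)^{-β} ds is bounded by C · t^{-θ}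
for all t ≥ 2. -/
theorem convolution_integral_bound_of_max_ne_one
    (α β : ℝ) (hα : 0 < α) (hβ : 0 < β) (hmax : max α β ≠ 1) :
    ∃ C : ℝ, 0 < C ∧ ∀ t : ℝ, 2 ≤ t →
      (∫ s in (1:ℝ)..(t - 1), s ^ (-α) * (t - s) ^ (-β))
        ≤ C * t ^ (-(min α (min β (α + β - 1)))) := by
  set θ := min α (min β (α + β - 1)) with hθ
  have hθα : θ ≤ α := min_le_left _ _
  have hθβ : θ ≤ β := (min_le_right _ _).trans (min_le_left _ _)
  have hθs : θ ≤ α + β - 1 := (min_le_right _ _).trans (min_le_right _ _)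
  obtain ⟨C₁, hC₁, h₁⟩ := exists_half_convolution_integral_le α β θ hβ hθβ hθs (by
    intro h
    rcases lt_or_ge 1 β with hb | hb
    · linarith
    · exact absurd (by rw [h, max_eq_left hb]) hmax)
  obtain ⟨C₂, hC₂, h₂⟩ := exists_half_convolution_integral_le β α θ hα hθα (by linarith) (by
    intro h
    rcases lt_or_ge 1 α with ha | ha
    · linarith
    · exact absurd (by rw [h, max_eq_right ha]) hmax)
  refine ⟨C₁ + C₂, by positivity, fun t ht => ?_⟩
  have hreflect : (∫ s in (t / 2)..(t - 1), s ^ (-α) * (t - s) ^ (-β))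
      = ∫ s in (1:ℝ)..(t / 2), s ^ (-β) * (t - s) ^ (-α) := by
    have h := intervalIntegral.integral_comp_sub_left (a := t / 2) (b := t - 1)
      (fun s : ℝ => s ^ (-β) * (t - s) ^ (-α)) t
    simp only [sub_sub_cancel, sub_half] at h
    rw [← h]
    simp only [mul_comm]
  rw [← intervalIntegral.integral_add_adjacent_intervals
    (intervalIntegrable_rpow_mul_sub_rpow α β (by linarith : 1 ≤ t / 2) one_pos (by linarith))
    (intervalIntegrable_rpow_mul_sub_rpow α β (by linarith : t / 2 ≤ t - 1) (by linarith)
      (by linarith)), hreflect, add_mul]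
  exact add_le_add (h₁ t ht) (h₂ t ht)
end

section
/- Let α, β > 0 be real numbers. Then for all real t ≥ 2 the following two-sided estimate holds: (t−1)^{−β} · ∫_1^{t/2} s^{−α} ds + (t−1)^{−α} · ∫_1^{t/2} u^{−β} du ≤ ∫_1^{t−1} s^{−α} (t−s)^{−β} ds ≤ (t/2)^{−β} · ∫_1^{t/2} s^{−α} ds + (t/2)^{−α} · ∫_1^{t/2} u^{−β} du. -/
open intervalIntegral in
/-- On `[1, t / 2]` the factor `(t - s) ^ (-β)` lies between its values at the endpoints. -/
theorem integral_rpow_mul_sub_rpow_bounds {α β t : ℝ} (hβ : 0 ≤ β) (ht : 2 ≤ t) :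
    IntervalIntegrable (fun s : ℝ => s ^ (-α) * (t - s) ^ (-β)) MeasureTheory.volume 1 (t / 2) ∧
    (t - 1) ^ (-β) * (∫ s in (1:ℝ)..(t / 2), s ^ (-α))
      ≤ (∫ s in (1:ℝ)..(t / 2), s ^ (-α) * (t - s) ^ (-β)) ∧
    (∫ s in (1:ℝ)..(t / 2), s ^ (-α) * (t - s) ^ (-β))
      ≤ (t / 2) ^ (-β) * (∫ s in (1:ℝ)..(t / 2), s ^ (-α)) := by
  have hle : (1:ℝ) ≤ t / 2 := by linarith
  have hpow : ContinuousOn (fun s : ℝ => s ^ (-α)) (Set.uIcc 1 (t / 2)) := by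
    rw [Set.uIcc_of_le hle]
    exact continuousOn_id.rpow_const fun s hs => Or.inl (by simp only [id]; linarith [hs.1])
  have hsub : ContinuousOn (fun s : ℝ => (t - s) ^ (-β)) (Set.uIcc 1 (t / 2)) := by
    rw [Set.uIcc_of_le hle]
    exact (continuousOn_const.sub continuousOn_id).rpow_const fun s hs =>
      Or.inl (by simp only [Pi.sub_apply, id]; linarith [hs.2])
  have hint := (hpow.mul hsub).intervalIntegrable (μ := MeasureTheory.volume)
  refine ⟨hint, ?_, ?_⟩
  · rw [← integral_const_mul]
    refine integral_mono_on hle (hpow.intervalIntegrable.const_mul _) hint fun s hs => ?_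
    rw [mul_comm]
    exact mul_le_mul_of_nonneg_left
      (Real.rpow_le_rpow_of_nonpos (by linarith [hs.2]) (by linarith [hs.1]) (by linarith))
      (Real.rpow_nonneg (by linarith [hs.1]) _)
  · rw [← integral_const_mul]
    refine integral_mono_on hle hint (hpow.intervalIntegrable.const_mul _) fun s hs => ?_
    rw [mul_comm ((t / 2) ^ (-β))]
    exact mul_le_mul_of_nonneg_left
      (Real.rpow_le_rpow_of_nonpos (by linarith) (by linarith [hs.2]) (by linarith))
      (Real.rpow_nonneg (by linarith [hs.1]) _)

/-- Two-sided estimate for the convolution-type integral obtained by splitting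
at s = t/2 and bounding the non-singular factor by its extreme values:
for all t ≥ 2,
(t−1)^{−β}·∫_1^{t/2} s^{−α} ds + (t−1)^{−α}·∫_1^{t/2} u^{−β} du
  ≤ ∫_1^{t−1} s^{−α}(t−s)^{−β} ds
  ≤ (t/2)^{−β}·∫_1^{t/2} s^{−α} ds + (t/2)^{−α}·∫_1^{t/2} u^{−β} du. -/
theorem convolution_integral_two_sided_estimate
    (α β : ℝ) (hα : 0 < α) (hβ : 0 < β) :
    ∀ t : ℝ, 2 ≤ t →
      ((t - 1) ^ (-β) * ∫ s in (1:ℝ)..(t / 2), s ^ (-α))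
          + ((t - 1) ^ (-α) * ∫ u in (1:ℝ)..(t / 2), u ^ (-β))
        ≤ (∫ s in (1:ℝ)..(t - 1), s ^ (-α) * (t - s) ^ (-β)) ∧
      (∫ s in (1:ℝ)..(t - 1), s ^ (-α) * (t - s) ^ (-β))
        ≤ ((t / 2) ^ (-β) * ∫ s in (1:ℝ)..(t / 2), s ^ (-α))
          + ((t / 2) ^ (-α) * ∫ u in (1:ℝ)..(t / 2), u ^ (-β)) := by
  intro t ht
  obtain ⟨hint₁, hlow₁, hupp₁⟩ := integral_rpow_mul_sub_rpow_bounds (α := α) hβ.le ht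
  obtain ⟨hint₂, hlow₂, hupp₂⟩ := integral_rpow_mul_sub_rpow_bounds (α := β) hα.le ht
  have hreflect : (fun s : ℝ => s ^ (-α) * (t - s) ^ (-β)) =
      fun s => (fun u : ℝ => u ^ (-β) * (t - u) ^ (-α)) (t - s) := by
    funext s
    simp [mul_comm]
  have hint₃ : IntervalIntegrable (fun s : ℝ => s ^ (-α) * (t - s) ^ (-β))
      MeasureTheory.volume (t / 2) (t - 1) := by
    have h := (hint₂.comp_sub_left t).symm
    rw [sub_half] at h
    rwa [hreflect]
  have hhalf : (∫ s in (t / 2)..(t - 1), s ^ (-α) * (t - s) ^ (-β)) =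
      ∫ u in (1:ℝ)..(t / 2), u ^ (-β) * (t - u) ^ (-α) := by
    rw [hreflect, intervalIntegral.integral_comp_sub_left
      (fun u : ℝ => u ^ (-β) * (t - u) ^ (-α)) t, sub_sub_cancel, sub_half]
  rw [← intervalIntegral.integral_add_adjacent_intervals hint₁ hint₃, hhalf]
  exact ⟨add_le_add hlow₁ hlow₂, add_le_add hupp₁ hupp₂⟩
end
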